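/- Let Γ₁, Γ₂ be positive continuous radial functions on ℝ^N with Γᵢ(r) ∼ r^{bᵢ} e^{−η r} as r → ∞ (same exponential rate η > 0), and assume b₁ ≥ b₂ > −(N+1)/2. Then as |ξ| → ∞, ∫_{ℝ^N} Γ₁(x − ξ) Γ₂(x) dx ∼ |ξ|^{b₁+b₂+(N+1)/2} e^{−η|ξ|}. -/

import Mathlib

open MeasureTheory

lemma aux_rpow_cmp {x y K b : ℝ} (hx : 0 < x) (hy : 0 < y) (hK : 1 ≤ K) (h1 : x ≤ K * y)
    (h2 : y ≤ K * x) : x ^ b ≤ K ^ |b| * y ^ b := by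
  have hK0 : 0 < K := by linarith
  rcases le_or_gt 0 b with hb | hb
  · rw [abs_of_nonneg hb, ← Real.mul_rpow hK0.le hy.le]
    exact Real.rpow_le_rpow hx.le h1 hb
  · rw [abs_of_neg hb]
    have h3 : y / K ≤ x := by rw [div_le_iff₀ hK0]; linarith
    have := Real.rpow_le_rpow_of_nonpos (div_pos hy hK0) h3 hb.le
    rw [Real.div_rpow hy.le hK0.le] at this
    rw [Real.rpow_neg hK0.le]
    calc x ^ b ≤ _ := this
      _ = _ := by ring

lemma aux_gamma_bound (Γ : ℝ → ℝ) (b η : ℝ) (hc : Continuous Γ) (hpos : ∀ r : ℝ, 0 ≤ r → 0 < Γ r)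
    (has : ∃ c c' r₀ : ℝ, 0 < c ∧ 0 < c' ∧ ∀ r : ℝ, r₀ ≤ r →
      c * r ^ b * Real.exp (-η * r) ≤ Γ r ∧ Γ r ≤ c' * r ^ b * Real.exp (-η * r)) :
    ∃ A : ℝ, 0 < A ∧ ∀ r : ℝ, 0 ≤ r → Γ r ≤ A * ((1 + r) ^ b * Real.exp (-η * r)) ∧
      (1 + r) ^ b * Real.exp (-η * r) ≤ A * Γ r := by
  obtain ⟨c, c', r₀, hc0, hc0', h⟩ := has
  have hcw : ContinuousOn (fun r : ℝ => (1 + r) ^ b * Real.exp (-η * r)) (Set.Icc 0 (max r₀ 1)) := by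
    apply ContinuousOn.mul
    · apply ContinuousOn.rpow_const (by fun_prop)
      intro x hx; left; have := hx.1; linarith
    · fun_prop
  have hw : ∀ r : ℝ, 0 ≤ r → 0 < (1 + r) ^ b * Real.exp (-η * r) := by
    intro r hr; positivity
  obtain ⟨A1, hA1⟩ := (isCompact_Icc (a := (0:ℝ)) (b := max r₀ 1)).exists_bound_of_continuousOn
    (hc.continuousOn.div hcw (fun x hx => (hw x hx.1).ne'))
  obtain ⟨A2, hA2⟩ := (isCompact_Icc (a := (0:ℝ)) (b := max r₀ 1)).exists_bound_of_continuousOn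
    (hcw.div hc.continuousOn (fun x hx => (hpos x hx.1).ne'))
  set B := (2:ℝ) ^ |b| with hB
  have hB0 : 0 < B := by positivity
  refine ⟨|A1| + |A2| + c' * B + B / c, by positivity, fun r hr => ?_⟩
  have hwr := hw r hr
  have hgr := hpos r hr
  set w := (1 + r) ^ b * Real.exp (-η * r) with hwdef
  have p1 : 0 < c' * B := by positivity
  have p2 : 0 < B / c := by positivity
  rcases le_or_gt r (max r₀ 1) with hr1 | hr1
  · have e1 := (Real.le_norm_self _).trans (hA1 r ⟨hr, hr1⟩)
    have e2 := (Real.le_norm_self _).trans (hA2 r ⟨hr, hr1⟩)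
    simp only [Pi.div_apply] at e1 e2
    rw [div_le_iff₀ hwr] at e1
    rw [div_le_iff₀ hgr] at e2
    constructor
    · refine e1.trans (mul_le_mul_of_nonneg_right ?_ hwr.le)
      have := le_abs_self A1; have := abs_nonneg A2; linarith
    · refine e2.trans (mul_le_mul_of_nonneg_right ?_ hgr.le)
      have := le_abs_self A2; have := abs_nonneg A1; linarith
  · have hr0 : r₀ ≤ r := (le_max_left _ _).trans hr1.le
    have hr2 : 1 ≤ r := (le_max_right _ _).trans hr1.le
    obtain ⟨l, u⟩ := h r hr0
    have k1 : r ^ b ≤ B * (1 + r) ^ b := aux_rpow_cmp (by linarith) (by linarith) (by norm_num) (by linarith) (by linarith)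
    have k2 : (1 + r) ^ b ≤ B * r ^ b := aux_rpow_cmp (by linarith) (by linarith) (by norm_num) (by linarith) (by linarith)
    have hE := Real.exp_pos (-η * r)
    have := abs_nonneg A1
    have := abs_nonneg A2
    constructor
    · calc Γ r ≤ c' * r ^ b * Real.exp (-η * r) := u
        _ ≤ c' * (B * (1 + r) ^ b) * Real.exp (-η * r) := by gcongr
        _ = c' * B * w := by rw [hwdef]; ring
        _ ≤ _ := by gcongr; linarith
    · calc w ≤ B * r ^ b * Real.exp (-η * r) := by rw [hwdef]; gcongr
        _ = B / c * (c * r ^ b * Real.exp (-η * r)) := by field_simp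
        _ ≤ B / c * Γ r := by gcongr
        _ ≤ _ := by gcongr; linarith

lemma aux_exp_poly (q κ : ℝ) (hκ : 0 < κ) : ∃ M : ℝ, 0 < M ∧ ∀ r : ℝ, 0 ≤ r →
    (1 + r) ^ q * Real.exp (-κ * r) ≤ M := by
  obtain ⟨n, hn⟩ := exists_nat_ge q
  refine ⟨n.factorial / κ ^ n * Real.exp κ, by positivity, fun r hr => ?_⟩
  have h1 : (1 + r) ^ q ≤ (1 + r) ^ n := by
    rw [← Real.rpow_natCast]
    exact Real.rpow_le_rpow_of_exponent_le (by linarith) hn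
  have h2 := Real.pow_div_factorial_le_exp (κ * (1 + r)) (by positivity) n
  have h3 : (1 + r) ^ n ≤ n.factorial / κ ^ n * Real.exp (κ * (1 + r)) := by
    rw [mul_pow, div_le_iff₀ (by positivity)] at h2
    rw [div_mul_eq_mul_div, le_div_iff₀ (by positivity)]
    linarith
  calc _ ≤ n.factorial / κ ^ n * Real.exp (κ * (1 + r)) * Real.exp (-κ * r) := by
        gcongr; exact h1.trans h3
    _ = _ := by rw [mul_assoc, ← Real.exp_add]; ring_nf

lemma aux_int_poly_exp (N : ℕ) (p κ : ℝ) (hκ : 0 < κ) : ∃ D : ℝ, 0 < D ∧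
    ∫⁻ x : EuclideanSpace ℝ (Fin N), ENNReal.ofReal ((1 + ‖x‖) ^ p * Real.exp (-κ * ‖x‖))
      ≤ ENNReal.ofReal D := by
  obtain ⟨M, hM, h⟩ := aux_exp_poly (p + (N + 1)) κ hκ
  have hi : Integrable (fun x : EuclideanSpace ℝ (Fin N) => M * (1 + ‖x‖) ^ (-((N : ℝ) + 1))) :=
    (integrable_one_add_norm (by simp)).const_mul M
  refine ⟨(∫ x : EuclideanSpace ℝ (Fin N), M * (1 + ‖x‖) ^ (-((N : ℝ) + 1))) + 1, ?_, ?_⟩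
  · have : 0 ≤ ∫ x : EuclideanSpace ℝ (Fin N), M * (1 + ‖x‖) ^ (-((N : ℝ) + 1)) :=
      integral_nonneg (fun x => by positivity)
    linarith
  · refine le_trans ?_ (ENNReal.ofReal_le_ofReal (le_add_of_nonneg_right zero_le_one))
    rw [ofReal_integral_eq_lintegral_ofReal hi (Filter.Eventually.of_forall fun x => by positivity)]
    refine lintegral_mono fun x => ENNReal.ofReal_le_ofReal ?_
    have h1 := h ‖x‖ (norm_nonneg x)
    have h0 : 0 < 1 + ‖x‖ := by positivity
    calc (1 + ‖x‖) ^ p * Real.exp (-κ * ‖x‖)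
        = ((1 + ‖x‖) ^ (p + (N + 1)) * Real.exp (-κ * ‖x‖)) * (1 + ‖x‖) ^ (-((N : ℝ) + 1)) := by
          rw [mul_right_comm, ← Real.rpow_add h0]; congr 2; ring
      _ ≤ _ := by gcongr

lemma aux_gauss (N : ℕ) (k : ℝ) (hk : 0 < k) (p : EuclideanSpace ℝ (Fin N)) :
    ∫⁻ x : EuclideanSpace ℝ (Fin N), ENNReal.ofReal (Real.exp (-k * ‖x - p‖ ^ 2))
      = ENNReal.ofReal ((Real.pi / k) ^ ((N : ℝ) / 2)) := by
  rw [lintegral_sub_right_eq_self (fun x : EuclideanSpace ℝ (Fin N) =>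
    ENNReal.ofReal (Real.exp (-k * ‖x‖ ^ 2))) p]
  have := GaussianFourier.integral_rexp_neg_mul_sq_norm (V := EuclideanSpace ℝ (Fin N)) hk
  rw [finrank_euclideanSpace_fin] at this
  rw [← this, ofReal_integral_eq_lintegral_ofReal]
  · by_contra hcon
    rw [integral_undef hcon] at this
    have : 0 < (Real.pi / k) ^ ((N : ℝ) / 2) := by positivity
    linarith
  · exact Filter.Eventually.of_forall fun x => by positivity

/-- Case A: main region. -/
lemma aux_caseA (a b η : ℝ) (hη : 0 < η) : ∃ K : ℝ, 0 < K ∧ ∀ r v d t s q : ℝ, 1 ≤ d → 0 ≤ r →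
    0 ≤ v → v ^ 2 = r ^ 2 - 2 * t * d + d ^ 2 → r ≤ v → t ≤ r → r / 2 ≤ t →
    t ≤ s → s ≤ t + √(1 + t) → q = r ^ 2 - 2 * s * t + s ^ 2 →
    (1 + v) ^ a * (1 + r) ^ b * Real.exp (-η * (r + v - d)) ≤
      √(1 + t) * (K * d ^ a * ((1 + s) ^ (b - 1 / 2) * Real.exp (-(η / 4 / (1 + s)) * q))) := by
  refine ⟨3 ^ |a| * (2 ^ |b| * (2 ^ |b - 1 / 2| * Real.exp (η / 4))), by positivity, ?_⟩
  intro r v d t s q hd hr hv hv2 hrv htr hrt hts hst hq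
  have ht0 : 0 ≤ t := by linarith
  have hdt : t ≤ d / 2 := by nlinarith
  have hvt : d - t ≤ v := abs_le_of_sq_le_sq' (by nlinarith) hv |>.2
  have hvu : v ≤ d + r := abs_le_of_sq_le_sq' (by nlinarith) (by linarith) |>.2
  have h1t : 0 < 1 + t := by linarith
  have hsq : √(1 + t) ≤ 1 + t := by
    rw [Real.sqrt_le_left (by linarith)]; nlinarith
  have hs1 : 1 + s ≤ 2 * (1 + t) := by linarith
  have h1s : 0 < 1 + s := by linarith
  have hsq2 : √(1 + t) ^ 2 = 1 + t := Real.sq_sqrt h1t.le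
  have k1 : (1 + v) ^ a ≤ 3 ^ |a| * d ^ a :=
    aux_rpow_cmp (by linarith) (by linarith) (by norm_num) (by linarith) (by linarith)
  have k2 : (1 + r) ^ b ≤ 2 ^ |b| * (1 + t) ^ b :=
    aux_rpow_cmp (by linarith) (by linarith) (by norm_num) (by linarith) (by linarith)
  have k3 : (1 + t) ^ (b - 1 / 2) ≤ 2 ^ |b - 1 / 2| * (1 + s) ^ (b - 1 / 2) :=
    aux_rpow_cmp (by linarith) (by linarith) (by norm_num) (by linarith) (by linarith)
  have k4 : (1 + t) ^ b = √(1 + t) * (1 + t) ^ (b - 1 / 2) := by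
    rw [Real.sqrt_eq_rpow, ← Real.rpow_add h1t]; congr 1; ring
  have k5 : Real.exp (-η * (r + v - d)) ≤ Real.exp (η / 4) * Real.exp (-(η / 4 / (1 + s)) * q) := by
    rw [← Real.exp_add, Real.exp_le_exp]
    have hq1 : q ≤ (r ^ 2 - t ^ 2) + (1 + t) := by
      have : (s - t) ^ 2 ≤ √(1 + t) ^ 2 := by
        apply pow_le_pow_left₀ <;> linarith
      nlinarith
    have hq2 : q / (1 + s) ≤ 4 * (r - t) + 1 := by
      rw [div_le_iff₀ h1s]
      have e1 : r ^ 2 - t ^ 2 ≤ 4 * (r - t) * (1 + s) := by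
        have : (r - t) * (r + t) ≤ (r - t) * (4 * (1 + s)) :=
          mul_le_mul_of_nonneg_left (by linarith) (by linarith)
        linarith
      linarith
    have : -(η / 4 / (1 + s)) * q = -(η / 4) * (q / (1 + s)) := by ring
    rw [this]
    nlinarith
  have h1v : 0 < 1 + v := by linarith
  have h1r : 0 < 1 + r := by linarith
  have hd0 : 0 < d := by linarith
  calc (1 + v) ^ a * (1 + r) ^ b * Real.exp (-η * (r + v - d))
      ≤ (3 ^ |a| * d ^ a) * (2 ^ |b| * (√(1 + t) * (2 ^ |b - 1 / 2| * (1 + s) ^ (b - 1 / 2)))) *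
        (Real.exp (η / 4) * Real.exp (-(η / 4 / (1 + s)) * q)) := by
        have : (1 + r) ^ b ≤ 2 ^ |b| * (√(1 + t) * (2 ^ |b - 1 / 2| * (1 + s) ^ (b - 1 / 2))) := by
          refine k2.trans ?_
          rw [k4]
          gcongr
        gcongr
    _ = _ := by ring

/-- Case B: the remainder. -/
lemma aux_caseB (a b η : ℝ) (hη : 0 < η) : ∃ K : ℝ, 0 < K ∧ ∀ r v d t : ℝ, 1 ≤ d → 0 ≤ r →
    0 ≤ v → v ^ 2 = r ^ 2 - 2 * t * d + d ^ 2 → r ≤ v → |t| ≤ r → t < r / 2 →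
    (1 + v) ^ a * (1 + r) ^ b * Real.exp (-η * (r + v - d)) ≤
      K * d ^ a * ((1 + r) ^ (|a| + b) * Real.exp (-(η / 2) * r)) := by
  refine ⟨2 ^ |a|, by positivity, ?_⟩
  intro r v d t hd hr hv hv2 hrv htr hrt
  have hdt : t ≤ d / 2 := by nlinarith
  have ht2 : t ^ 2 ≤ r ^ 2 := sq_le_sq' (by linarith [neg_le_of_abs_le htr]) (le_of_abs_le htr)
  have hvt : d - t ≤ v := abs_le_of_sq_le_sq' (by nlinarith) hv |>.2
  have htr' := neg_le_of_abs_le htr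
  have hvu : v ≤ d + r := abs_le_of_sq_le_sq' (by nlinarith) (by linarith) |>.2
  have h1v : 0 < 1 + v := by linarith
  have h1r : 0 < 1 + r := by linarith
  have hd0 : 0 < d := by linarith
  have k1 : (1 + v) ^ a ≤ (2 * (1 + r)) ^ |a| * d ^ a :=
    aux_rpow_cmp (by linarith) (by linarith) (by linarith) (by nlinarith) (by nlinarith)
  rw [Real.mul_rpow (by norm_num) h1r.le] at k1
  have k2 : Real.exp (-η * (r + v - d)) ≤ Real.exp (-(η / 2) * r) := by
    rw [Real.exp_le_exp]; nlinarith
  calc _ ≤ (2 ^ |a| * (1 + r) ^ |a| * d ^ a) * (1 + r) ^ b * Real.exp (-(η / 2) * r) := by gcongr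
    _ = _ := by rw [Real.rpow_add h1r]; ring

noncomputable def auxInner (N : ℕ) (b η : ℝ) (ξ x : EuclideanSpace ℝ (Fin N)) (s : ℝ) : ENNReal :=
  ENNReal.ofReal ((1 + s) ^ (b - 1 / 2) *
    Real.exp (-(η / 4 / (1 + s)) * ‖x - (s / ‖ξ‖) • ξ‖ ^ 2))

noncomputable def auxB (N : ℕ) (a b η : ℝ) (ξ x : EuclideanSpace ℝ (Fin N)) : ENNReal :=
  ENNReal.ofReal (‖ξ‖ ^ a) *
    (ENNReal.ofReal ((1 + ‖x‖) ^ (|a| + b) * Real.exp (-(η / 2) * ‖x‖)) +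
      ∫⁻ s in Set.Icc 0 (2 * ‖ξ‖), auxInner N b η ξ x s)

lemma aux_geom {N : ℕ} (ξ x : EuclideanSpace ℝ (Fin N)) (hξ : 0 < ‖ξ‖) :
    ∃ t : ℝ, |t| ≤ ‖x‖ ∧ ‖x - ξ‖ ^ 2 = ‖x‖ ^ 2 - 2 * t * ‖ξ‖ + ‖ξ‖ ^ 2 ∧
      ∀ s : ℝ, ‖x - (s / ‖ξ‖) • ξ‖ ^ 2 = ‖x‖ ^ 2 - 2 * s * t + s ^ 2 := by
  have h := abs_real_inner_le_norm x ξ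
  refine ⟨inner ℝ x ξ / ‖ξ‖, ?_, ?_, ?_⟩
  · rw [abs_div, abs_of_pos hξ, div_le_iff₀ hξ]; exact h
  · rw [norm_sub_sq_real]; field_simp
  · intro s
    rw [norm_sub_sq_real, inner_smul_right, norm_smul, mul_pow, Real.norm_eq_abs, sq_abs]
    field_simp

lemma aux_pw (N : ℕ) (a b η : ℝ) (hη : 0 < η) : ∃ K : ℝ, 0 < K ∧
    ∀ ξ x : EuclideanSpace ℝ (Fin N), 1 ≤ ‖ξ‖ → ‖x‖ ≤ ‖x - ξ‖ →
    ENNReal.ofReal ((1 + ‖x - ξ‖) ^ a * (1 + ‖x‖) ^ b * Real.exp (-η * (‖x‖ + ‖x - ξ‖ - ‖ξ‖)))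
      ≤ ENNReal.ofReal K * auxB N a b η ξ x := by
  obtain ⟨K1, hK1, hA⟩ := aux_caseA a b η hη
  obtain ⟨K2, hK2, hB⟩ := aux_caseB a b η hη
  refine ⟨K1 + K2, by positivity, fun ξ x hd hxx => ?_⟩
  have hd0 : 0 < ‖ξ‖ := by linarith
  obtain ⟨t, ht, hv, hs⟩ := aux_geom ξ x hd0
  have hr := norm_nonneg x
  have hv0 := norm_nonneg (x - ξ)
  set F := (1 + ‖x - ξ‖) ^ a * (1 + ‖x‖) ^ b * Real.exp (-η * (‖x‖ + ‖x - ξ‖ - ‖ξ‖)) with hF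
  have hF0 : 0 ≤ F := by positivity
  unfold auxB
  rw [← mul_assoc, ← ENNReal.ofReal_mul (by positivity)]
  rcases lt_or_ge t (‖x‖ / 2) with h | h
  · have := hB _ _ _ t hd hr hv0 hv hxx ht h
    rw [← hF] at this
    calc ENNReal.ofReal F ≤ ENNReal.ofReal ((K1 + K2) * ‖ξ‖ ^ a * ((1 + ‖x‖) ^ (|a| + b) * Real.exp (-(η / 2) * ‖x‖))) := by
          refine ENNReal.ofReal_le_ofReal (this.trans ?_)
          gcongr; linarith
      _ = _ := ENNReal.ofReal_mul (by positivity)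
      _ ≤ _ := by gcongr; exact le_self_add
  · have ht0 : 0 ≤ t := by linarith
    have htd : t ≤ ‖ξ‖ / 2 := by nlinarith
    have hsq0 : 0 < √(1 + t) := by positivity
    have hsq : √(1 + t) ≤ 1 + t := by
      rw [Real.sqrt_le_left (by linarith)]; nlinarith
    calc ENNReal.ofReal F = ∫⁻ s in Set.Icc t (t + √(1 + t)), ENNReal.ofReal (F / √(1 + t)) := by
          rw [setLIntegral_const, Real.volume_Icc, ← ENNReal.ofReal_mul (by positivity)]
          congr 1; field_simp; ring
      _ ≤ ∫⁻ s in Set.Icc t (t + √(1 + t)), ENNReal.ofReal ((K1 + K2) * ‖ξ‖ ^ a) * auxInner N b η ξ x s := by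
          refine setLIntegral_mono' measurableSet_Icc fun s hs' => ?_
          unfold auxInner
          rw [← ENNReal.ofReal_mul (by positivity)]
          refine ENNReal.ofReal_le_ofReal ?_
          have := hA _ _ _ t s _ hd hr hv0 hv hxx (le_of_abs_le ht) h hs'.1 hs'.2 (hs s)
          rw [← hF] at this
          have h1s : 0 < 1 + s := by linarith [hs'.1]
          rw [div_le_iff₀' hsq0]
          refine this.trans ?_
          gcongr; linarith
      _ ≤ ∫⁻ s in Set.Icc 0 (2 * ‖ξ‖), ENNReal.ofReal ((K1 + K2) * ‖ξ‖ ^ a) * auxInner N b η ξ x s := by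
          refine lintegral_mono_set (Set.Icc_subset_Icc ht0 (by linarith))
      _ = ENNReal.ofReal ((K1 + K2) * ‖ξ‖ ^ a) * ∫⁻ s in Set.Icc 0 (2 * ‖ξ‖), auxInner N b η ξ x s := by
          rw [lintegral_const_mul']
          exact ENNReal.ofReal_ne_top
      _ ≤ _ := by gcongr; exact le_add_self

lemma aux_inner_meas (N : ℕ) (b η : ℝ) (ξ : EuclideanSpace ℝ (Fin N)) :
    Measurable (Function.uncurry (auxInner N b η ξ)) := by
  unfold auxInner Function.uncurry
  fun_prop

lemma aux_intB (N : ℕ) (a b η : ℝ) (hη : 0 < η) (hb : b > -((N : ℝ) + 1) / 2) : ∃ C : ℝ, 0 < C ∧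
    ∀ ξ : EuclideanSpace ℝ (Fin N), 1 ≤ ‖ξ‖ →
    ∫⁻ x, auxB N a b η ξ x ≤ ENNReal.ofReal (C * ‖ξ‖ ^ (a + b + ((N : ℝ) + 1) / 2)) := by
  obtain ⟨D, hD, hDi⟩ := aux_int_poly_exp N (|a| + b) (η / 2) (by positivity)
  set p := b + ((N : ℝ) + 1) / 2 with hp
  have hp0 : 0 < p := by rw [hp]; linarith
  set G := (Real.pi / (η / 4)) ^ ((N : ℝ) / 2) with hG
  have hG0 : 0 < G := by positivity
  refine ⟨D + G * (3 ^ p / p), by positivity, fun ξ hd => ?_⟩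
  have hd0 : 0 < ‖ξ‖ := by linarith
  have hmeas := aux_inner_meas N b η ξ
  unfold auxB
  rw [lintegral_const_mul' _ _ ENNReal.ofReal_ne_top, lintegral_add_left (by fun_prop),
    lintegral_lintegral_swap hmeas.aemeasurable]
  have hin : ∀ s ∈ Set.Icc 0 (2 * ‖ξ‖), ∫⁻ x, auxInner N b η ξ x s = ENNReal.ofReal (G * (1 + s) ^ (p - 1)) := by
    intro s hs
    have h1s : 0 < 1 + s := by linarith [hs.1]
    unfold auxInner
    simp_rw [ENNReal.ofReal_mul (Real.rpow_nonneg h1s.le (b - 1 / 2))]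
    rw [lintegral_const_mul' _ _ ENNReal.ofReal_ne_top, aux_gauss N _ (by positivity), ← ENNReal.ofReal_mul (by positivity)]
    congr 1
    have : Real.pi / (η / 4 / (1 + s)) = Real.pi / (η / 4) * (1 + s) := by field_simp
    rw [this, Real.mul_rpow (by positivity) h1s.le, ← hG, mul_left_comm, ← Real.rpow_add h1s]
    congr 2; rw [hp]; ring
  rw [setLIntegral_congr_fun measurableSet_Icc hin]
  have hIntBound : ∫⁻ s in Set.Icc 0 (2 * ‖ξ‖), ENNReal.ofReal (G * (1 + s) ^ (p - 1)) ≤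
      ENNReal.ofReal (G * (3 ^ p / p) * ‖ξ‖ ^ p) := by
    have hcont : ContinuousOn (fun s : ℝ => G * (1 + s) ^ (p - 1)) (Set.Icc 0 (2 * ‖ξ‖)) := by
      apply ContinuousOn.mul continuousOn_const
      apply ContinuousOn.rpow_const (by fun_prop)
      intro x hx; left; have := hx.1; linarith
    rw [← ofReal_integral_eq_lintegral_ofReal (hcont.integrableOn_Icc)
      ((ae_restrict_iff' measurableSet_Icc).2 (Filter.Eventually.of_forall fun s hs => by
        have h1s : 0 < 1 + s := by linarith [hs.1]
        positivity))]
    refine ENNReal.ofReal_le_ofReal ?_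
    rw [integral_Icc_eq_integral_Ioc, ← intervalIntegral.integral_of_le (by positivity),
      intervalIntegral.integral_const_mul,
      intervalIntegral.integral_comp_add_left (fun s : ℝ => s ^ (p - 1)) 1,
      integral_rpow (Or.inl (by linarith))]
    rw [mul_assoc]
    gcongr
    rw [sub_add_cancel, div_mul_eq_mul_div, ← Real.mul_rpow (by norm_num) hd0.le]
    gcongr
    have h1 : (1 + 2 * ‖ξ‖) ^ p ≤ (3 * ‖ξ‖) ^ p := by
      apply Real.rpow_le_rpow <;> linarith
    have h2 : 0 ≤ (1 + (0:ℝ)) ^ p := by positivity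
    linarith
  have hone : 1 ≤ ‖ξ‖ ^ p := Real.one_le_rpow hd hp0.le
  calc _ ≤ ENNReal.ofReal (‖ξ‖ ^ a) * (ENNReal.ofReal (D * ‖ξ‖ ^ p) + ENNReal.ofReal (G * (3 ^ p / p) * ‖ξ‖ ^ p)) := by
        gcongr
        exact hDi.trans (ENNReal.ofReal_le_ofReal (le_mul_of_one_le_right hD.le hone))
    _ = _ := by
        rw [← ENNReal.ofReal_add (by positivity) (by positivity), ← ENNReal.ofReal_mul (by positivity)]
        congr 1
        have : a + b + ((N : ℝ) + 1) / 2 = a + p := by rw [hp]; ring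
        rw [this, Real.rpow_add hd0 a p]; ring

lemma aux_upper (N : ℕ) (a b η : ℝ) (hη : 0 < η) (ha : a > -((N : ℝ) + 1) / 2)
    (hb : b > -((N : ℝ) + 1) / 2) : ∃ C : ℝ, 0 < C ∧
    ∀ ξ : EuclideanSpace ℝ (Fin N), 1 ≤ ‖ξ‖ →
    ∫⁻ x, ENNReal.ofReal ((1 + ‖x - ξ‖) ^ a * (1 + ‖x‖) ^ b *
      Real.exp (-η * (‖x‖ + ‖x - ξ‖ - ‖ξ‖)))
      ≤ ENNReal.ofReal (C * ‖ξ‖ ^ (a + b + ((N : ℝ) + 1) / 2)) := by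
  obtain ⟨K1, hK1, h1⟩ := aux_pw N a b η hη
  obtain ⟨K2, hK2, h2⟩ := aux_pw N b a η hη
  obtain ⟨C1, hC1, i1⟩ := aux_intB N a b η hη hb
  obtain ⟨C2, hC2, i2⟩ := aux_intB N b a η hη ha
  refine ⟨K1 * C1 + K2 * C2, by positivity, fun ξ hd => ?_⟩
  have hmB : Measurable (fun x => auxB N a b η ξ x) := by
    have := (aux_inner_meas N b η ξ).lintegral_prod_right' (ν := volume.restrict (Set.Icc 0 (2 * ‖ξ‖)))
    unfold auxB
    simp only [Function.uncurry] at this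
    fun_prop
  calc _ ≤ ∫⁻ x, (ENNReal.ofReal K1 * auxB N a b η ξ x + ENNReal.ofReal K2 * auxB N b a η ξ (ξ - x)) := by
        refine lintegral_mono fun x => ?_
        rcases le_total ‖x‖ ‖x - ξ‖ with h | h
        · exact (h1 ξ x hd h).trans le_self_add
        · refine le_trans ?_ le_add_self
          have e1 : ‖ξ - x‖ = ‖x - ξ‖ := norm_sub_rev _ _
          have e2 : ‖ξ - x - ξ‖ = ‖x‖ := by rw [sub_sub_cancel_left, norm_neg]
          have := h2 ξ (ξ - x) hd (by rw [e1, e2]; exact h)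
          rw [e1, e2] at this
          refine le_trans (le_of_eq ?_) this
          congr 1
          rw [mul_comm ((1 + ‖x - ξ‖) ^ a), add_comm ‖x‖ ‖x - ξ‖]
    _ = ENNReal.ofReal K1 * (∫⁻ x, auxB N a b η ξ x) + ENNReal.ofReal K2 * ∫⁻ x, auxB N b a η ξ x := by
        rw [lintegral_add_left (by fun_prop), lintegral_const_mul' _ _ ENNReal.ofReal_ne_top,
          lintegral_const_mul' _ _ ENNReal.ofReal_ne_top,
          lintegral_sub_left_eq_self (fun x => auxB N b a η ξ x) ξ]
    _ ≤ ENNReal.ofReal K1 * ENNReal.ofReal (C1 * ‖ξ‖ ^ (a + b + ((N : ℝ) + 1) / 2)) +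
        ENNReal.ofReal K2 * ENNReal.ofReal (C2 * ‖ξ‖ ^ (b + a + ((N : ℝ) + 1) / 2)) := by
        gcongr
        · exact i1 ξ hd
        · exact i2 ξ hd
    _ = _ := by
        rw [← ENNReal.ofReal_mul (by positivity), ← ENNReal.ofReal_mul (by positivity),
          ← ENNReal.ofReal_add (by positivity) (by positivity), add_comm b a]
        congr 1; ring

/-- Lower bound of the integrand near the middle of the segment. -/
lemma aux_low_pw (a b η : ℝ) (hη : 0 < η) : ∃ κ : ℝ, 0 < κ ∧ ∀ r v d t s : ℝ, 36 ≤ d → 0 ≤ r →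
    0 ≤ v → v ^ 2 = r ^ 2 - 2 * t * d + d ^ 2 → |t| ≤ r → d / 3 ≤ s → s ≤ 2 * d / 3 →
    r ^ 2 - 2 * s * t + s ^ 2 ≤ d →
    κ * (d ^ a * d ^ b) ≤ (1 + v) ^ a * (1 + r) ^ b * Real.exp (-η * (r + v - d)) := by
  refine ⟨(6 ^ |a|)⁻¹ * (6 ^ |b|)⁻¹ * Real.exp (-η * 6), by positivity, ?_⟩
  intro r v d t s hd hr hv hv2 htr hs1 hs2 hq
  have ht2 : t ^ 2 ≤ r ^ 2 := sq_le_sq' (by linarith [neg_le_of_abs_le htr]) (le_of_abs_le htr)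
  have hst : (s - t) ^ 2 ≤ (d / 6) ^ 2 := by nlinarith
  have ⟨l, u⟩ := abs_le_of_sq_le_sq' hst (by linarith)
  have hy : r ^ 2 - t ^ 2 ≤ d := by nlinarith
  have ht6 : d / 6 ≤ t := by linarith
  have ht7 : d / 6 ≤ d - t := by linarith
  have hr1 : r ≤ t + 3 := abs_le_of_sq_le_sq' (by nlinarith) (by linarith) |>.2
  have hv1 : v ≤ (d - t) + 3 := abs_le_of_sq_le_sq' (by nlinarith) (by linarith) |>.2
  have hr2 := le_of_abs_le htr
  have hv3 : d - t ≤ v := abs_le_of_sq_le_sq' (by nlinarith) hv |>.2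
  have k1 : d ^ a ≤ 6 ^ |a| * (1 + v) ^ a :=
    aux_rpow_cmp (by linarith) (by linarith) (by norm_num) (by linarith) (by linarith)
  have k2 : d ^ b ≤ 6 ^ |b| * (1 + r) ^ b :=
    aux_rpow_cmp (by linarith) (by linarith) (by norm_num) (by linarith) (by linarith)
  have k3 : Real.exp (-η * 6) ≤ Real.exp (-η * (r + v - d)) := by
    rw [Real.exp_le_exp]; nlinarith
  have h1v : 0 < 1 + v := by linarith
  have h1r : 0 < 1 + r := by linarith
  have hd0 : 0 < d := by linarith
  rw [← inv_mul_le_iff₀ (by positivity)] at k1 k2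
  calc _ = ((6 ^ |a|)⁻¹ * d ^ a) * ((6 ^ |b|)⁻¹ * d ^ b) * Real.exp (-η * 6) := by ring
    _ ≤ _ := by gcongr

lemma aux_lower (N : ℕ) (a b η : ℝ) (hη : 0 < η) : ∃ κ : ℝ, 0 < κ ∧
    ∀ ξ : EuclideanSpace ℝ (Fin N), 36 ≤ ‖ξ‖ →
    ENNReal.ofReal (κ * ‖ξ‖ ^ (a + b + ((N : ℝ) + 1) / 2)) ≤
    ∫⁻ x, ENNReal.ofReal ((1 + ‖x - ξ‖) ^ a * (1 + ‖x‖) ^ b *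
      Real.exp (-η * (‖x‖ + ‖x - ξ‖ - ‖ξ‖))) := by
  obtain ⟨κ, hκ, hlow⟩ := aux_low_pw a b η hη
  set V := (volume (Metric.closedBall (0 : EuclideanSpace ℝ (Fin N)) 1)).toReal with hV
  have hVpos : 0 < V := ENNReal.toReal_pos (Metric.measure_closedBall_pos _ _ one_pos).ne'
    measure_closedBall_lt_top.ne
  refine ⟨κ * V / 6, by positivity, fun ξ hd => ?_⟩
  have hd0 : 0 < ‖ξ‖ := by linarith
  set d := ‖ξ‖ with hddef
  set S : Set (EuclideanSpace ℝ (Fin N) × ℝ) := {z | ‖z.1 - (z.2 / d) • ξ‖ ^ 2 ≤ d} with hS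
  have hSm : MeasurableSet S := by
    apply IsClosed.measurableSet
    apply isClosed_le <;> fun_prop
  set φ : EuclideanSpace ℝ (Fin N) → ℝ → ENNReal := fun x s => S.indicator 1 (x, s) with hφ
  have hφm : Measurable (Function.uncurry φ) := by
    have : Function.uncurry φ = S.indicator 1 := by ext ⟨x, s⟩; rfl
    rw [this]
    exact measurable_one.indicator hSm
  set J := Set.Icc (d / 3) (2 * d / 3) with hJ
  have hsd : 0 < √d := Real.sqrt_pos.2 hd0
  have hsd2 : √d ^ 2 = d := Real.sq_sqrt hd0.le
  -- the double integral
  have hswap : ∫⁻ x, ∫⁻ s in J, φ x s = ENNReal.ofReal (d / 3 * (V * d ^ ((N : ℝ) / 2))) := by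
    rw [lintegral_lintegral_swap hφm.aemeasurable]
    have : ∀ s : ℝ, ∫⁻ x, φ x s = ENNReal.ofReal (V * d ^ ((N : ℝ) / 2)) := by
      intro s
      have e : (fun x => φ x s) = (Metric.closedBall ((s / d) • ξ) √d).indicator 1 := by
        ext x
        simp only [hφ, hS, Set.indicator, Metric.mem_closedBall, Set.mem_ofPred_eq, dist_eq_norm,
          Pi.one_apply]
        congr 1
        rw [Real.le_sqrt (norm_nonneg _) hd0.le]
      rw [e, lintegral_indicator_one Metric.isClosed_closedBall.measurableSet,
        Measure.addHaar_closedBall' _ _ hsd.le, finrank_euclideanSpace_fin, mul_comm V,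
        ENNReal.ofReal_mul (by positivity), hV, ENNReal.ofReal_toReal measure_closedBall_lt_top.ne]
      congr 2
      rw [Real.sqrt_eq_rpow, ← Real.rpow_natCast, ← Real.rpow_mul hd0.le]
      congr 1; ring
    simp_rw [this]
    rw [setLIntegral_const, hJ, Real.volume_Icc, ← ENNReal.ofReal_mul (by positivity)]
    congr 1; ring
  -- pointwise
  have hpw : ∀ x, ENNReal.ofReal (κ * (d ^ a * d ^ b)) * ∫⁻ s in J, φ x s ≤
      ENNReal.ofReal (2 * √d) * ENNReal.ofReal ((1 + ‖x - ξ‖) ^ a * (1 + ‖x‖) ^ b *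
      Real.exp (-η * (‖x‖ + ‖x - ξ‖ - d))) := by
    intro x
    obtain ⟨t, ht, hv, hs⟩ := aux_geom ξ x hd0
    rw [← hddef] at hv hs
    by_cases hex : ∃ s ∈ J, ‖x - (s / d) • ξ‖ ^ 2 ≤ d
    · obtain ⟨s, hsJ, hsd'⟩ := hex
      rw [hs] at hsd'
      have h := hlow _ _ d t s hd (norm_nonneg x) (norm_nonneg (x - ξ)) hv ht hsJ.1 hsJ.2 hsd'
      have hle : ∫⁻ s in J, φ x s ≤ ENNReal.ofReal (2 * √d) := by
        calc ∫⁻ s in J, φ x s ≤ ∫⁻ s, φ x s := setLIntegral_le_lintegral _ _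
          _ ≤ ∫⁻ s, (Set.Icc (t - √d) (t + √d)).indicator 1 s := by
              refine lintegral_mono fun s => ?_
              simp only [hφ]
              by_cases hm : (x, s) ∈ S
              · have hm' := hm
                simp only [hS, Set.mem_ofPred_eq] at hm'
                rw [hs] at hm'
                have ht2 : t ^ 2 ≤ ‖x‖ ^ 2 := sq_le_sq' (by linarith [neg_le_of_abs_le ht]) (le_of_abs_le ht)
                have ⟨l, u⟩ := abs_le_of_sq_le_sq' (show (s - t) ^ 2 ≤ √d ^ 2 by nlinarith) hsd.le
                have hmem : s ∈ Set.Icc (t - √d) (t + √d) := ⟨by linarith, by linarith⟩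
                rw [Set.indicator_of_mem hm, Set.indicator_of_mem hmem]
                simp
              · rw [Set.indicator_of_notMem hm]; exact zero_le
          _ = ENNReal.ofReal (2 * √d) := by
              rw [lintegral_indicator_one measurableSet_Icc, Real.volume_Icc]; congr 1; ring
      rw [mul_comm]
      exact mul_le_mul' hle (ENNReal.ofReal_le_ofReal h)
    · have : ∫⁻ s in J, φ x s = 0 := by
        have e : ∀ s ∈ J, φ x s = 0 := fun s hsJ =>
          Set.indicator_of_notMem (s := S) (a := (x, s)) (fun hm => hex ⟨s, hsJ, hm⟩) 1
        rw [setLIntegral_congr_fun (g := fun _ => 0) measurableSet_Icc e]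
        simp
      rw [this, mul_zero]; exact zero_le
  have hfin := lintegral_mono (μ := volume) hpw
  rw [lintegral_const_mul' _ _ ENNReal.ofReal_ne_top, lintegral_const_mul' _ _ ENNReal.ofReal_ne_top,
    hswap, ← ENNReal.ofReal_mul (by positivity)] at hfin
  have hc : κ * (d ^ a * d ^ b) * (d / 3 * (V * d ^ ((N : ℝ) / 2))) =
      2 * √d * (κ * V / 6 * d ^ (a + b + ((N : ℝ) + 1) / 2)) := by
    have : a + b + ((N : ℝ) + 1) / 2 = a + b + (N : ℝ) / 2 + 1 / 2 := by ring
    rw [this, Real.rpow_add hd0, Real.rpow_add hd0, Real.rpow_add hd0, ← Real.sqrt_eq_rpow]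
    have : d / 3 = √d ^ 2 / 3 := by rw [hsd2]
    rw [this]; ring
  rw [hc, ENNReal.ofReal_mul (by positivity)] at hfin
  exact (ENNReal.mul_le_mul_iff_right (by simpa using hsd) ENNReal.ofReal_ne_top).1 hfin

theorem stmt_5 (N : ℕ) (Γ₁ Γ₂ : ℝ → ℝ) (b₁ b₂ η : ℝ)
    (hη : 0 < η) (hb : b₁ ≥ b₂) (hb₂ : b₂ > -((N : ℝ) + 1) / 2)
    (hcont₁ : Continuous Γ₁) (hcont₂ : Continuous Γ₂)
    (hpos₁ : ∀ r : ℝ, 0 ≤ r → 0 < Γ₁ r) (hpos₂ : ∀ r : ℝ, 0 ≤ r → 0 < Γ₂ r)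
    (hasymp₁ : ∃ c c' r₀ : ℝ, 0 < c ∧ 0 < c' ∧ ∀ r : ℝ, r₀ ≤ r →
      c * r ^ b₁ * Real.exp (-η * r) ≤ Γ₁ r ∧ Γ₁ r ≤ c' * r ^ b₁ * Real.exp (-η * r))
    (hasymp₂ : ∃ c c' r₀ : ℝ, 0 < c ∧ 0 < c' ∧ ∀ r : ℝ, r₀ ≤ r →
      c * r ^ b₂ * Real.exp (-η * r) ≤ Γ₂ r ∧ Γ₂ r ≤ c' * r ^ b₂ * Real.exp (-η * r)) :
    ∃ C R₀ : ℝ, 1 ≤ C ∧ ∀ ξ : EuclideanSpace ℝ (Fin N), R₀ ≤ ‖ξ‖ →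
      (1 / C) * (‖ξ‖ ^ (b₁ + b₂ + ((N : ℝ) + 1) / 2) * Real.exp (-η * ‖ξ‖))
          ≤ (∫ x : EuclideanSpace ℝ (Fin N), Γ₁ ‖x - ξ‖ * Γ₂ ‖x‖) ∧
      (∫ x : EuclideanSpace ℝ (Fin N), Γ₁ ‖x - ξ‖ * Γ₂ ‖x‖)
          ≤ C * (‖ξ‖ ^ (b₁ + b₂ + ((N : ℝ) + 1) / 2) * Real.exp (-η * ‖ξ‖)) := by
  obtain ⟨A1, hA1, g1⟩ := aux_gamma_bound Γ₁ b₁ η hcont₁ hpos₁ hasymp₁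
  obtain ⟨A2, hA2, g2⟩ := aux_gamma_bound Γ₂ b₂ η hcont₂ hpos₂ hasymp₂
  obtain ⟨U, hU, hup⟩ := aux_upper N b₁ b₂ η hη (by linarith) hb₂
  obtain ⟨κ, hκ, hlo⟩ := aux_lower N b₁ b₂ η hη
  set C := 1 + A1 * A2 * U + A1 * A2 / κ with hC
  have hp1 : 0 < A1 * A2 * U := by positivity
  have hp2 : 0 < A1 * A2 / κ := by positivity
  have hC1 : 1 ≤ C := by rw [hC]; linarith
  refine ⟨C, 36, hC1, fun ξ hd => ?_⟩
  have hd0 : 0 < ‖ξ‖ := by linarith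
  have hup := hup ξ (by linarith)
  have hlo := hlo ξ hd
  set P := ‖ξ‖ ^ (b₁ + b₂ + ((N : ℝ) + 1) / 2) with hP
  have hP0 : 0 < P := by positivity
  set F : EuclideanSpace ℝ (Fin N) → ℝ := fun x => (1 + ‖x - ξ‖) ^ b₁ * (1 + ‖x‖) ^ b₂ *
      Real.exp (-η * (‖x‖ + ‖x - ξ‖ - ‖ξ‖)) with hF
  set I : EuclideanSpace ℝ (Fin N) → ℝ := fun x => Γ₁ ‖x - ξ‖ * Γ₂ ‖x‖ with hI
  have hF0 : ∀ x, 0 ≤ F x := fun x => by simp only [hF]; positivity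
  have hI0 : ∀ x, 0 ≤ I x := fun x =>
    mul_nonneg (hpos₁ _ (norm_nonneg _)).le (hpos₂ _ (norm_nonneg _)).le
  have hFm : Measurable F := by simp only [hF]; fun_prop
  have hIc : Continuous I := by simp only [hI]; fun_prop
  have hFi : Integrable F := by
    refine ⟨hFm.aestronglyMeasurable, ?_⟩
    rw [hasFiniteIntegral_iff_ofReal (Filter.Eventually.of_forall hF0)]
    exact hup.trans_lt ENNReal.ofReal_lt_top
  have hFup : ∫ x, F x ≤ U * P := by
    rw [← ofReal_integral_eq_lintegral_ofReal hFi (Filter.Eventually.of_forall hF0)] at hup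
    exact (ENNReal.ofReal_le_ofReal_iff (by positivity)).1 hup
  have hFlo : κ * P ≤ ∫ x, F x := by
    rw [← ofReal_integral_eq_lintegral_ofReal hFi (Filter.Eventually.of_forall hF0)] at hlo
    exact (ENNReal.ofReal_le_ofReal_iff (integral_nonneg hF0)).1 hlo
  set E := Real.exp (-η * ‖ξ‖) with hE
  have hE0 : 0 < E := Real.exp_pos _
  have hFE : ∀ x, E * F x = ((1 + ‖x - ξ‖) ^ b₁ * Real.exp (-η * ‖x - ξ‖)) *
      ((1 + ‖x‖) ^ b₂ * Real.exp (-η * ‖x‖)) := by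
    intro x
    have : Real.exp (-η * ‖x - ξ‖) * Real.exp (-η * ‖x‖) =
        E * Real.exp (-η * (‖x‖ + ‖x - ξ‖ - ‖ξ‖)) := by
      rw [hE, ← Real.exp_add, ← Real.exp_add]; congr 1; ring
    simp only [hF]
    linear_combination (-(1 + ‖x - ξ‖) ^ b₁ * (1 + ‖x‖) ^ b₂) * this
  have hIF : ∀ x, I x ≤ A1 * A2 * E * F x := by
    intro x
    calc I x ≤ _ := mul_le_mul (g1 _ (norm_nonneg (x - ξ))).1 (g2 _ (norm_nonneg x)).1
            (hpos₂ _ (norm_nonneg _)).le (by positivity)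
      _ = A1 * A2 * (E * F x) := by rw [hFE]; ring
      _ = _ := by ring
  have hFI : ∀ x, E * F x ≤ A1 * A2 * I x := by
    intro x
    rw [hFE]
    have q1 := hpos₁ _ (norm_nonneg (x - ξ))
    calc _ ≤ _ := mul_le_mul (g1 _ (norm_nonneg (x - ξ))).2 (g2 _ (norm_nonneg x)).2
            (by positivity) (by positivity)
      _ = A1 * A2 * I x := by simp only [hI]; ring
  have hIi : Integrable I := by
    refine (hFi.const_mul (A1 * A2 * E)).mono' hIc.aestronglyMeasurable
      (Filter.Eventually.of_forall fun x => ?_)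
    rw [Real.norm_of_nonneg (hI0 x)]; exact hIF x
  have j1 : ∫ x, I x ≤ A1 * A2 * E * ∫ x, F x := by
    rw [← integral_const_mul]
    exact integral_mono hIi (hFi.const_mul _) hIF
  have j2 : E * ∫ x, F x ≤ A1 * A2 * ∫ x, I x := by
    rw [← integral_const_mul, ← integral_const_mul]
    exact integral_mono (hFi.const_mul _) (hIi.const_mul _) hFI
  have hC0 : 0 < C := by linarith
  constructor
  · rw [one_div, inv_mul_le_iff₀ hC0]
    have hIn : 0 ≤ ∫ x, I x := integral_nonneg hI0
    have : κ * (P * E) ≤ A1 * A2 * ∫ x, I x := by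
      refine le_trans ?_ j2
      calc κ * (P * E) = E * (κ * P) := by ring
        _ ≤ _ := by gcongr
    calc P * E ≤ A1 * A2 / κ * ∫ x, I x := by
          rw [div_mul_eq_mul_div, le_div_iff₀ hκ]; linarith
      _ ≤ _ := by gcongr; rw [hC]; linarith
  · calc ∫ x, I x ≤ A1 * A2 * E * (U * P) := j1.trans (by gcongr)
      _ = A1 * A2 * U * (P * E) := by ring
      _ ≤ _ := by gcongr; rw [hC]; linarith
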